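/- Let h : [0,L] → (0,∞) be continuous and L-periodic, let Ω_h = {(x,y) : x ∈ (0,L), 0 < y < h(x)}, and let u : Ω_h → ℝ² be a C¹ divergence-free vector field, L-periodic in x, with u(x,0) = 0 and u(x, h(x)) = η̇(x) e₂ for a continuous function η̇. Then the Korn-type identity 2 ∫_{Ω_h} |D(u)|² dx dy = ∫_{Ω_h} |∇u|² dx dy holds, where D(u) = (∇u + ∇uᵀ)/2. -/

import Mathlib

open MeasureTheory

/-- The subgraph domain `Ω_h = {(x,y) : x ∈ (0,L), 0 < y < h(x)}`. -/
def subgraph (L : ℝ) (h : ℝ → ℝ) : Set (ℝ × ℝ) :=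
  {p | p.1 ∈ Set.Ioo 0 L ∧ p.2 ∈ Set.Ioo 0 (h p.1)}

theorem lip_aux (L H : ℝ) (h : ℝ → ℝ) (hcont : Continuous h)
    (f : ℝ × ℝ → ℝ) (hf : ContDiff ℝ 1 f) (ftop : ∀ x, f (x, h x) = 0)
    (M : ℝ) (hM : ∀ p ∈ Set.Icc (-1) (L + 1) ×ˢ Set.Icc 0 H, |fderiv ℝ f p (1, 0)| ≤ M)
    (a b y : ℝ) (ha : a ∈ Set.Icc (-1) (L + 1)) (hb : b ∈ Set.Icc (-1) (L + 1))
    (hy : y ∈ Set.Icc 0 H) :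
    |(if y < h a then f (a, y) else 0) - (if y < h b then f (b, y) else 0)| ≤ M * |a - b| := by
  have hM0 : 0 ≤ M := (abs_nonneg _).trans (hM (a, y) ⟨ha, hy⟩)
  have key : ∀ c ∈ Set.Icc (-1) (L + 1), ∀ d ∈ Set.Icc (-1) (L + 1),
      |f (c, y) - f (d, y)| ≤ M * |c - d| := by
    intro c hc d hd
    have := (convex_Icc (-1 : ℝ) (L + 1)).norm_image_sub_le_of_norm_hasDerivWithin_le
      (f := fun t => f (t, y)) (f' := fun t => fderiv ℝ f (t, y) (1, 0)) (C := M)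
      (fun t _ => by
        have h1 : HasDerivAt (fun t : ℝ => (t, y)) ((1 : ℝ), (0 : ℝ)) t :=
          (hasDerivAt_id t).prodMk (hasDerivAt_const t y)
        exact (((hf.differentiable one_ne_zero (t, y)).hasFDerivAt).comp_hasDerivAt t h1).hasDerivWithinAt)
      (fun t ht => hM (t, y) ⟨ht, hy⟩) hd hc
    simpa using this
  have key2 : ∀ c ∈ Set.Icc (-1) (L + 1), ∀ d ∈ Set.Icc (-1) (L + 1), y < h c → ¬ y < h d →
      |f (c, y)| ≤ M * |c - d| := by
    intro c hc d hd h1 h2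
    obtain ⟨z, hz, hzy⟩ := intermediate_value_uIcc (a := c) (b := d) hcont.continuousOn
      (show y ∈ Set.uIcc (h c) (h d) from Set.mem_uIcc.2 (Or.inr ⟨not_lt.1 h2, h1.le⟩))
    have hzI : z ∈ Set.Icc (-1) (L + 1) := Set.uIcc_subset_Icc hc hd hz
    have h3 := key c hc z hzI
    have h0 : f (z, y) = 0 := by rw [← hzy]; exact ftop z
    rw [h0, sub_zero] at h3
    refine h3.trans (mul_le_mul_of_nonneg_left ?_ hM0)
    have := Set.abs_sub_left_of_mem_uIcc hz
    rwa [abs_sub_comm z c, abs_sub_comm d c] at this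
  split_ifs with h1 h2 h2
  · exact key a ha b hb
  · simpa using key2 a ha b hb h1 h2
  · have := key2 b hb a ha h2 h1
    rw [abs_sub_comm a b]; simpa using this
  · simpa using mul_nonneg hM0 (abs_nonneg (a - b))

theorem hasDerivAt_slice_fst (f : ℝ × ℝ → ℝ) (hf : ContDiff ℝ 1 f) (x y : ℝ) :
    HasDerivAt (fun t => f (t, y)) (fderiv ℝ f (x, y) (1, 0)) x :=
  ((hf.differentiable one_ne_zero (x, y)).hasFDerivAt).comp_hasDerivAt x
    ((hasDerivAt_id x).prodMk (hasDerivAt_const x y))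

theorem hasDerivAt_slice_snd (f : ℝ × ℝ → ℝ) (hf : ContDiff ℝ 1 f) (x y : ℝ) :
    HasDerivAt (fun t => f (x, t)) (fderiv ℝ f (x, y) (0, 1)) y :=
  ((hf.differentiable one_ne_zero (x, y)).hasFDerivAt).comp_hasDerivAt y
    ((hasDerivAt_const y x).prodMk (hasDerivAt_id y))

theorem cont_fderiv (f : ℝ × ℝ → ℝ) (hf : ContDiff ℝ 1 f) (v : ℝ × ℝ) :
    Continuous (fun p => fderiv ℝ f p v) :=
  (hf.continuous_fderiv one_ne_zero).clm_apply continuous_const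

theorem intOn (L H : ℝ) (φ : ℝ × ℝ → ℝ) (hφ : Continuous φ) :
    IntegrableOn φ (Set.Ioo 0 L ×ˢ Set.Ioo 0 H) :=
  (hφ.continuousOn.integrableOn_compact
    (isCompact_Icc.prod isCompact_Icc : IsCompact (Set.Icc 0 L ×ˢ Set.Icc 0 H))).mono_set
    (Set.prod_mono Set.Ioo_subset_Icc_self Set.Ioo_subset_Icc_self)

theorem meas_lt (k : ℝ → ℝ) (hk : Continuous k) : MeasurableSet {p : ℝ × ℝ | p.2 < k p.1} :=
  measurableSet_lt measurable_snd (hk.measurable.comp measurable_fst)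

theorem null_graph (h : ℝ → ℝ) (hcont : Continuous h) :
    ∀ᵐ p : ℝ × ℝ, p.2 ≠ h p.1 := by
  have hm : MeasurableSet {p : ℝ × ℝ | p.2 = h p.1} :=
    measurableSet_eq_fun measurable_snd (hcont.measurable.comp measurable_fst)
  rw [ae_iff]
  simp only [ne_eq, not_not]
  rw [Measure.volume_eq_prod, Measure.measure_prod_null hm]
  refine Filter.Eventually.of_forall fun x => ?_
  simp [Set.preimage]

theorem claim1 (L H : ℝ) (h : ℝ → ℝ) (hcont : Continuous h)
    (f g : ℝ × ℝ → ℝ) (hf : ContDiff ℝ 1 f) (hg : Continuous g) (ftop : ∀ x, f (x, h x) = 0) :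
    HasDerivAt (fun s => ∫ p in Set.Ioo 0 L ×ˢ Set.Ioo 0 H,
        (if p.2 < h (p.1 + s) then f (p.1 + s, p.2) else 0) * g p)
      (∫ p in Set.Ioo 0 L ×ˢ Set.Ioo 0 H,
        (if p.2 < h p.1 then fderiv ℝ f p (1, 0) else 0) * g p) 0 := by
  obtain ⟨M, hM⟩ := (isCompact_Icc.prod isCompact_Icc :
    IsCompact (Set.Icc (-1) (L + 1) ×ˢ Set.Icc 0 H)).exists_bound_of_continuousOn
      (cont_fderiv f hf (1, 0)).continuousOn
  have hmeas : ∀ s : ℝ, Measurable fun p : ℝ × ℝ =>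
      (if p.2 < h (p.1 + s) then f (p.1 + s, p.2) else 0) * g p := by
    intro s
    refine Measurable.mul (Measurable.ite (meas_lt (fun x => h (x + s)) (by fun_prop)) ?_
      measurable_const) hg.measurable
    have := hf.continuous
    exact Continuous.measurable (by fun_prop)
  have hR : MeasurableSet (Set.Ioo 0 L ×ˢ Set.Ioo 0 H) := measurableSet_Ioo.prod measurableSet_Ioo
  refine (hasDerivAt_integral_of_dominated_loc_of_lip (bound := fun p => M * |g p|)
    (Metric.ball_mem_nhds (0 : ℝ) one_pos) (Filter.Eventually.of_forall fun s => (hmeas s).aestronglyMeasurable)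
    ?_ ?_ ?_ ?_ ?_).2
  · have h1 : IntegrableOn (fun p => f p * g p) (Set.Ioo 0 L ×ˢ Set.Ioo 0 H) :=
      intOn L H _ (hf.continuous.mul hg)
    refine Integrable.mono h1 (hmeas 0).aestronglyMeasurable (Filter.Eventually.of_forall fun p => ?_)
    simp only [add_zero]
    split_ifs
    · simp
    · simp; positivity
  · refine (Measurable.mul (Measurable.ite (meas_lt h hcont) (cont_fderiv f hf _).measurable
      measurable_const) hg.measurable).aestronglyMeasurable
  · filter_upwards [ae_restrict_mem hR] with p hp
    rw [lipschitzOnWith_iff_dist_le_mul]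
    intro s hs t ht
    simp only [Metric.mem_ball, dist_zero_right, Real.norm_eq_abs, abs_lt] at hs ht
    obtain ⟨⟨h1, h2⟩, h3, h4⟩ := hp
    have hl := lip_aux L H h hcont f hf ftop M hM (p.1 + s) (p.1 + t) p.2
      ⟨by linarith, by linarith⟩ ⟨by linarith, by linarith⟩ ⟨h3.le, h4.le⟩
    rw [Real.dist_eq, Real.dist_eq, ← sub_mul, abs_mul, Real.coe_nnabs]
    have e : p.1 + s - (p.1 + t) = s - t := by ring
    rw [e] at hl
    calc _ ≤ M * |s - t| * |g p| := mul_le_mul_of_nonneg_right hl (abs_nonneg _)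
      _ = M * |g p| * |s - t| := by ring
      _ ≤ _ := mul_le_mul_of_nonneg_right (le_abs_self _) (abs_nonneg _)
  · exact intOn L H _ (by fun_prop)
  · filter_upwards [ae_restrict_of_ae (null_graph h hcont)] with p hp
    refine HasDerivAt.mul_const ?_ _
    have hc : Continuous fun s => h (p.1 + s) := by fun_prop
    rcases lt_or_gt_of_ne hp with h1 | h1
    · rw [if_pos h1]
      have h2 : HasDerivAt (fun s => f (p.1 + s, p.2)) (fderiv ℝ f p (1, 0)) 0 := by
        have := hasDerivAt_slice_fst f hf (p.1 + 0) p.2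
        have := this.comp_const_add p.1 0
        simpa using this
      refine h2.congr_of_eventuallyEq ?_
      have : ∀ᶠ s in nhds (0 : ℝ), p.2 < h (p.1 + s) :=
        hc.continuousAt.eventually_const_lt (by simpa using h1)
      filter_upwards [this] with s hs
      rw [if_pos hs]
    · rw [if_neg (not_lt.2 h1.le)]
      refine (hasDerivAt_const (0 : ℝ) (0 : ℝ)).congr_of_eventuallyEq ?_
      have : ∀ᶠ s in nhds (0 : ℝ), h (p.1 + s) < p.2 :=
        hc.continuousAt.eventually_lt_const (by simpa using h1)
      filter_upwards [this] with s hs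
      rw [if_neg (not_lt.2 hs.le)]

theorem claim2 (L H : ℝ) (h : ℝ → ℝ) (hcont : Continuous h)
    (k g : ℝ × ℝ → ℝ) (hk : Continuous k) (hg : ContDiff ℝ 1 g) :
    HasDerivAt (fun s => ∫ p in Set.Ioo 0 L ×ˢ Set.Ioo 0 H,
        (if p.2 < h p.1 then k p else 0) * g (p.1 - s, p.2))
      (∫ p in Set.Ioo 0 L ×ˢ Set.Ioo 0 H,
        (if p.2 < h p.1 then k p else 0) * (- fderiv ℝ g p (1, 0))) 0 := by
  obtain ⟨M, hM⟩ := (isCompact_Icc.prod isCompact_Icc :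
    IsCompact (Set.Icc (-1) (L + 1) ×ˢ Set.Icc 0 H)).exists_bound_of_continuousOn
      (cont_fderiv g hg (1, 0)).continuousOn
  have hgc := hg.continuous
  have hite : Measurable fun p : ℝ × ℝ => if p.2 < h p.1 then k p else 0 :=
    Measurable.ite (meas_lt h hcont) hk.measurable measurable_const
  have hmeas : ∀ s : ℝ, Measurable fun p : ℝ × ℝ =>
      (if p.2 < h p.1 then k p else 0) * g (p.1 - s, p.2) := by
    intro s
    exact hite.mul (Continuous.measurable (by fun_prop))
  have hR : MeasurableSet (Set.Ioo 0 L ×ˢ Set.Ioo 0 H) := measurableSet_Ioo.prod measurableSet_Ioo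
  have hle : ∀ p : ℝ × ℝ, |if p.2 < h p.1 then k p else 0| ≤ |k p| := by
    intro p; split_ifs <;> simp
  have := (hasDerivAt_integral_of_dominated_loc_of_deriv_le
    (μ := volume.restrict (Set.Ioo 0 L ×ˢ Set.Ioo 0 H))
    (F := fun s p => (if p.2 < h p.1 then k p else 0) * g (p.1 - s, p.2))
    (F' := fun s p => (if p.2 < h p.1 then k p else 0) * (- fderiv ℝ g (p.1 - s, p.2) (1, 0)))
    (bound := fun p => |k p| * M) (x₀ := (0 : ℝ))
    (Metric.ball_mem_nhds (0 : ℝ) one_pos) (Filter.Eventually.of_forall fun s => (hmeas s).aestronglyMeasurable)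
    ?_ ?_ ?_ ?_ ?_).2
  · simpa using this
  · have h1 : IntegrableOn (fun p => k p * g p) (Set.Ioo 0 L ×ˢ Set.Ioo 0 H) :=
      intOn L H _ (hk.mul hgc)
    refine Integrable.mono h1 (hmeas 0).aestronglyMeasurable (Filter.Eventually.of_forall fun p => ?_)
    simp only [sub_zero, norm_mul, Real.norm_eq_abs]
    exact mul_le_mul_of_nonneg_right (hle p) (abs_nonneg _)
  · have := cont_fderiv g hg (1, 0)
    simp only [sub_zero]
    exact (hite.mul this.neg.measurable).aestronglyMeasurable
  · filter_upwards [ae_restrict_mem hR] with p hp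
    intro s hs
    simp only [Metric.mem_ball, dist_zero_right, Real.norm_eq_abs, abs_lt] at hs
    obtain ⟨⟨h1, h2⟩, h3, h4⟩ := hp
    rw [norm_mul, norm_neg]
    exact mul_le_mul (hle p) (hM _ ⟨⟨by simp; linarith, by simp; linarith⟩, h3.le, h4.le⟩)
      (norm_nonneg _) (abs_nonneg _)
  · exact intOn L H _ (by fun_prop)
  · filter_upwards with p
    intro s _
    refine HasDerivAt.const_mul _ ?_
    exact (hasDerivAt_slice_fst g hg (p.1 - s) p.2).comp_const_sub p.1 s

theorem inner_eq (H : ℝ) (a : ℝ) (ha : 0 < a) (haH : a < H) (φ : ℝ → ℝ) (ψ : ℝ → ℝ) :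
    ∫ y in Set.Ioo 0 H, (if y < a then φ y else 0) * ψ y = ∫ y in (0:ℝ)..a, φ y * ψ y := by
  rw [intervalIntegral.integral_of_le ha.le, integral_Ioc_eq_integral_Ioo]
  have : (fun y => (if y < a then φ y else 0) * ψ y) = (Set.Iio a).indicator (fun y => φ y * ψ y) := by
    ext y; by_cases hy : y < a <;> simp [hy]
  rw [this, setIntegral_indicator measurableSet_Iio, Set.Ioo_inter_Iio, min_eq_right haH.le]

theorem shift_eq (L H : ℝ) (hL : 0 < L) (h : ℝ → ℝ) (hcont : Continuous h)
    (hpos : ∀ x, 0 < h x) (hper : Function.Periodic h L) (hH : ∀ x, h x < H)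
    (f g : ℝ × ℝ → ℝ) (hf : ContDiff ℝ 1 f) (hg : ContDiff ℝ 1 g)
    (fper : ∀ x y, f (x + L, y) = f (x, y)) (gper : ∀ x y, g (x + L, y) = g (x, y))
    (fbot : ∀ x, f (x, 0) = 0) (ftop : ∀ x, f (x, h x) = 0) (s : ℝ) :
    ∫ p in Set.Ioo 0 L ×ˢ Set.Ioo 0 H,
        (if p.2 < h (p.1 + s) then f (p.1 + s, p.2) else 0) * fderiv ℝ g p (0, 1)
     = - ∫ p in Set.Ioo 0 L ×ˢ Set.Ioo 0 H,
        (if p.2 < h p.1 then fderiv ℝ f p (0, 1) else 0) * g (p.1 - s, p.2) := by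
  have hfc := hf.continuous
  have hgc := hg.continuous
  have hfy := cont_fderiv f hf (0, 1)
  have hgy := cont_fderiv g hg (0, 1)
  have hint : ∀ (k : ℝ → ℝ) (φ ψ : ℝ × ℝ → ℝ), Continuous k → Continuous φ → Continuous ψ →
      IntegrableOn (fun p : ℝ × ℝ => (if p.2 < k p.1 then φ p else 0) * ψ p)
        (Set.Ioo 0 L ×ˢ Set.Ioo 0 H) (volume.prod volume) := by
    intro k φ ψ hk hφ hψ
    have h1 := (intOn L H (fun p => φ p * ψ p) (hφ.mul hψ)).indicator (meas_lt k hk)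
    refine h1.congr_fun (fun p _ => ?_) (measurableSet_Ioo.prod measurableSet_Ioo)
    by_cases hp : p.2 < k p.1 <;> simp [hp]
  rw [Measure.volume_eq_prod,
    setIntegral_prod _ (hint (fun x => h (x + s)) (fun p => f (p.1 + s, p.2))
      (fun p => fderiv ℝ g p (0, 1)) (by fun_prop) (by fun_prop) hgy),
    setIntegral_prod _ (hint h (fun p => fderiv ℝ f p (0, 1)) (fun p => g (p.1 - s, p.2))
      hcont hfy (by fun_prop))]
  simp only
  simp_rw [fun x => inner_eq H (h (x + s)) (hpos _) (hH _) (fun y => f (x + s, y))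
      (fun y => fderiv ℝ g (x, y) (0, 1)),
    fun x => inner_eq H (h x) (hpos _) (hH _) (fun y => fderiv ℝ f (x, y) (0, 1))
      (fun y => g (x - s, y))]
  set K : ℝ → ℝ := fun x => ∫ y in (0:ℝ)..h x, fderiv ℝ f (x, y) (0, 1) * g (x - s, y) with hK
  have hparts : ∀ x, ∫ y in (0:ℝ)..h (x + s), f (x + s, y) * fderiv ℝ g (x, y) (0, 1)
      = - K (x + s) := by
    intro x
    rw [intervalIntegral.integral_mul_deriv_eq_deriv_mul
      (fun y _ => hasDerivAt_slice_snd f hf (x + s) y) (fun y _ => hasDerivAt_slice_snd g hg x y)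
      (Continuous.intervalIntegrable (by fun_prop) _ _)
      (Continuous.intervalIntegrable (by fun_prop) _ _)]
    simp [hK, ftop, fbot]
  simp_rw [hparts]
  have hKper : Function.Periodic K L := by
    intro x
    simp only [hK, hper x]
    refine intervalIntegral.integral_congr fun y _ => ?_
    have h1 : fderiv ℝ f (x + L, y) (0, 1) = fderiv ℝ f (x, y) (0, 1) := by
      have e1 := hasDerivAt_slice_snd f hf (x + L) y
      simp_rw [fper] at e1
      exact e1.unique (hasDerivAt_slice_snd f hf x y)
    have h2 : g (x + L - s, y) = g (x - s, y) := by
      rw [← gper (x - s)]; congr 2; ring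
    simp only [h1, h2]
  rw [integral_neg, ← integral_Ioc_eq_integral_Ioo, ← integral_Ioc_eq_integral_Ioo,
    ← intervalIntegral.integral_of_le hL.le, ← intervalIntegral.integral_of_le hL.le,
    intervalIntegral.integral_comp_add_right]
  have := hKper.intervalIntegral_add_eq s 0
  simp only [zero_add] at this ⊢
  rw [← this, add_comm L s]

theorem stmt8 (L : ℝ) (hL : 0 < L) (h : ℝ → ℝ) (hcont : Continuous h)
    (hpos : ∀ x, 0 < h x) (hper : Function.Periodic h L)
    (u : ℝ × ℝ → ℝ × ℝ) (hu : ContDiff ℝ 1 u)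
    (huper : ∀ p : ℝ × ℝ, u (p.1 + L, p.2) = u p)
    (hdiv : ∀ p ∈ subgraph L h,
      fderiv ℝ (fun q => (u q).1) p (1, 0) + fderiv ℝ (fun q => (u q).2) p (0, 1) = 0)
    (ηd : ℝ → ℝ) (hηd : Continuous ηd)
    (hbot : ∀ x, u (x, 0) = 0)
    (htop : ∀ x, u (x, h x) = (0, ηd x)) :
    2 * (∫ p in subgraph L h,
          ((fderiv ℝ (fun q => (u q).1) p (1, 0)) ^ 2
            + 2 * (((fderiv ℝ (fun q => (u q).1) p (0, 1)
                + fderiv ℝ (fun q => (u q).2) p (1, 0)) / 2) ^ 2)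
            + (fderiv ℝ (fun q => (u q).2) p (0, 1)) ^ 2))
      = ∫ p in subgraph L h,
          ((fderiv ℝ (fun q => (u q).1) p (1, 0)) ^ 2
            + (fderiv ℝ (fun q => (u q).1) p (0, 1)) ^ 2
            + (fderiv ℝ (fun q => (u q).2) p (1, 0)) ^ 2
            + (fderiv ℝ (fun q => (u q).2) p (0, 1)) ^ 2) := by
  have hf : ContDiff ℝ 1 (fun q => (u q).1) := hu.fst
  have hg : ContDiff ℝ 1 (fun q => (u q).2) := hu.snd
  obtain ⟨H, hH⟩ : ∃ H, ∀ x, h x < H := by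
    obtain ⟨C, hC⟩ := (isCompact_Icc (a := (0:ℝ)) (b := L)).exists_bound_of_continuousOn
      hcont.continuousOn
    refine ⟨C + 1, fun x => ?_⟩
    obtain ⟨y, hy, hxy⟩ := hper.exists_mem_Ico₀ hL x
    rw [hxy]
    have := (le_abs_self _).trans (hC y ⟨hy.1, hy.2.le⟩)
    linarith
  have ftop : ∀ x, (fun q => (u q).1) (x, h x) = 0 := fun x => by simp [htop]
  have c1 := claim1 L H h hcont _ _ hf (cont_fderiv _ hg (0, 1)) ftop
  have c2 := (claim2 L H h hcont _ _ (cont_fderiv _ hf (0, 1)) hg).neg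
  have hs := shift_eq L H hL h hcont hpos hper hH _ _ hf hg
    (fun x y => by simp [huper (x, y)]) (fun x y => by simp [huper (x, y)])
    (fun x => by simp [hbot]) ftop
  have c3 := c1.unique (c2.congr_of_eventuallyEq (Filter.Eventually.of_forall hs))
  have hsub : ∀ φ ψ : ℝ × ℝ → ℝ, ∫ p in Set.Ioo 0 L ×ˢ Set.Ioo 0 H,
      (if p.2 < h p.1 then φ p else 0) * ψ p = ∫ p in subgraph L h, φ p * ψ p := by
    intro φ ψ
    have e : (fun p : ℝ × ℝ => (if p.2 < h p.1 then φ p else 0) * ψ p)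
        = {p : ℝ × ℝ | p.2 < h p.1}.indicator (fun p => φ p * ψ p) := by
      ext p; by_cases hp : p.2 < h p.1 <;> simp [hp]
    rw [e, setIntegral_indicator (meas_lt h hcont)]
    congr 2
    ext p
    simp only [subgraph, Set.mem_inter_iff, Set.mem_prod, Set.mem_Ioo, Set.mem_ofPred_eq]
    have := hH p.1
    constructor
    · rintro ⟨⟨h1, h2, h3⟩, h4⟩; exact ⟨h1, h2, h4⟩
    · rintro ⟨h1, h2, h4⟩; exact ⟨⟨h1, h2, h4.trans this⟩, h4⟩
  rw [hsub, hsub] at c3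
  have hms : MeasurableSet (subgraph L h) := by
    have e : subgraph L h = (Set.Ioo 0 L ×ˢ Set.Ioi 0) ∩ {p : ℝ × ℝ | p.2 < h p.1} := by
      ext p
      simp only [subgraph, Set.mem_inter_iff, Set.mem_prod, Set.mem_Ioo, Set.mem_ofPred_eq,
        Set.mem_Ioi]
      tauto
    rw [e]
    exact (measurableSet_Ioo.prod measurableSet_Ioi).inter (meas_lt h hcont)
  have hint : ∀ φ : ℝ × ℝ → ℝ, Continuous φ → IntegrableOn φ (subgraph L h) := fun φ hφ =>
    (intOn L H φ hφ).mono_set fun p hp => ⟨hp.1, hp.2.1, hp.2.2.trans (hH _)⟩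
  have k1 := cont_fderiv _ hf (1, 0)
  have k2 := cont_fderiv _ hf (0, 1)
  have k3 := cont_fderiv _ hg (1, 0)
  have k4 := cont_fderiv _ hg (0, 1)
  rw [← integral_const_mul, ← sub_eq_zero, ← integral_sub (hint _ (by fun_prop)) (hint _ (by fun_prop))]
  simp only [mul_neg, integral_neg, neg_neg] at c3
  have e2 := integral_sub (hint _ (k2.mul k3)) (hint _ (k1.mul k4))
  simp only [Pi.mul_apply] at e2
  rw [c3, sub_self] at e2
  have e3 := congrArg (fun t => 2 * t) e2
  simp only [mul_zero] at e3
  rw [← integral_const_mul] at e3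
  refine Eq.trans ?_ e3
  refine setIntegral_congr_fun hms fun p hp => ?_
  have hd := hdiv p hp
  have hd' := eq_neg_of_add_eq_zero_left hd
  rw [hd']
  ring
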